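/- Let A be an n×n pairwise comparison matrix with eigenvalue priority vector w_EV and geometric mean priority vector w_GM, each having pairwise distinct entries. Index the objects so that w_EV is strictly decreasing, let d = min over i of ((w_EV)_i − (w_EV)_{i+1}), κ = 1 − KI(A), and K = 1/κ² − 1. If k is an integer with 0 ≤ k ≤ n(n−1)/2 and (k+1)·d > K, then the number of discordant pairs between the rankings induced by w_EV and w_GM — i.e. the number of pairs i < j with sgn((w_EV)_i − (w_EV)_j) ≠ sgn((w_GM)_i − (w_GM)_j) — is at most k. -/

import Mathlib

/-- If every triad satisfies `c * (A i j * A j l) ≤ A i l`, then a positive eigenvector `w` has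
ratios `w i / w j` at least `c * A i j`. -/
lemma mul_eigenvector_le {ι : Type*} [Fintype ι] {A : Matrix ι ι ℝ} {c lam : ℝ} {w : ι → ℝ}
    (hpos : ∀ i j, 0 < A i j) (htriad : ∀ i j l, c * (A i j * A j l) ≤ A i l)
    (hw : ∀ i, 0 < w i) (heig : A.mulVec w = lam • w) (i j : ι) :
    c * A i j * w j ≤ w i := by
  have hrow : ∀ i, ∑ l, A i l * w l = lam * w i := fun i => by
    simpa [Matrix.mulVec, dotProduct] using congrFun heig i
  have hlam : 0 < lam := by
    have : 0 < lam * w i := by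
      rw [← hrow i]
      exact Finset.sum_pos (fun l _ => mul_pos (hpos i l) (hw l)) ⟨i, Finset.mem_univ i⟩
    exact pos_of_mul_pos_left this (hw i).le
  have hsum : c * A i j * ∑ l, A j l * w l ≤ ∑ l, A i l * w l := by
    rw [Finset.mul_sum]
    refine Finset.sum_le_sum fun l _ => ?_
    nlinarith [mul_le_mul_of_nonneg_right (htriad i j l) (hw l).le]
  rw [hrow, hrow] at hsum
  refine le_of_mul_le_mul_left ?_ hlam
  linarith

/-- If the row product of `i` is at most that of `j`, then `A i j` is at most `1 / c`. -/
lemma mul_le_one_of_prod_row_le {ι : Type*} [Fintype ι] {A : Matrix ι ι ℝ} {c : ℝ}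
    (hpos : ∀ i j, 0 < A i j) (hc : 0 < c) (htriad : ∀ i j l, c * (A i j * A j l) ≤ A i l)
    {i j : ι} (hle : ∏ l, A i l ≤ ∏ l, A j l) : c * A i j ≤ 1 := by
  have hcA : 0 < c * A i j := mul_pos hc (hpos i j)
  have hprod : (c * A i j) ^ Fintype.card ι * ∏ l, A j l ≤ ∏ l, A i l := by
    rw [← Finset.card_univ, ← Finset.prod_const, ← Finset.prod_mul_distrib]
    refine Finset.prod_le_prod (fun l _ => (mul_pos hcA (hpos j l)).le) fun l _ => ?_
    rw [mul_assoc]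
    exact htriad i j l
  have hP : 0 < ∏ l, A j l := Finset.prod_pos fun l _ => hpos j l
  have hpow : (c * A i j) ^ Fintype.card ι ≤ 1 := by
    refine le_of_mul_le_mul_right ?_ hP
    linarith
  have : Nonempty ι := ⟨i⟩
  exact (pow_le_one_iff_of_nonneg hcA.le Fintype.card_ne_zero).mp hpow

/-- A sequence whose adjacent gaps are at least `d` has gaps at least `(j - i) * d`. -/
lemma sub_mul_le_sub_of_adjacent {n : ℕ} {w : Fin n → ℝ} {d : ℝ}
    (hd : ∀ (i : Fin n) (h : (i : ℕ) + 1 < n), d ≤ w i - w ⟨(i : ℕ) + 1, h⟩)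
    (i : Fin n) (m : ℕ) (h : (i : ℕ) + m < n) : (m : ℝ) * d ≤ w i - w ⟨(i : ℕ) + m, h⟩ := by
  induction m with
  | zero => simp
  | succ m ih =>
    have hprev := ih (by omega)
    have hstep := hd ⟨(i : ℕ) + m, by omega⟩ h
    simp only [add_assoc] at hstep
    push_cast
    linarith

/-- If every pair in a relation contained in `<` has gap at most `K * w j`, then the number of
related pairs times the minimal adjacent gap is at most `K * ∑ j, w j`. -/
lemma card_pairs_mul_le {n : ℕ} {w : Fin n → ℝ} {d K : ℝ} (hdpos : 0 ≤ d) (hK : 0 ≤ K)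
    (hw : ∀ i, 0 < w i)
    (hd : ∀ (i : Fin n) (h : (i : ℕ) + 1 < n), d ≤ w i - w ⟨(i : ℕ) + 1, h⟩)
    (r : Fin n → Fin n → Prop) [DecidableRel r] (hlt : ∀ i j, r i j → i < j)
    (hgap : ∀ i j, r i j → w i - w j ≤ K * w j) :
    ((Finset.univ.filter fun p : Fin n × Fin n => r p.1 p.2).card : ℝ) * d ≤ K * ∑ j, w j := by
  rw [Finset.card_filter, Fintype.sum_prod_type_right]
  push_cast
  rw [Finset.sum_mul, Finset.mul_sum]
  refine Finset.sum_le_sum fun j _ => ?_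
  rw [← Finset.natCast_card_filter]
  rcases (Finset.univ.filter fun i => r i j).eq_empty_or_nonempty with hemp | hne
  · rw [hemp]
    simpa using mul_nonneg hK (hw j).le
  · obtain ⟨i, hi, hmin⟩ := Finset.exists_min_image _ id hne
    have hij : r i j := (Finset.mem_filter.mp hi).2
    have hcard : (Finset.univ.filter fun i => r i j).card ≤ (j : ℕ) - i := by
      rw [← Fin.card_Ico]
      refine Finset.card_le_card fun x hx => Finset.mem_Ico.mpr ⟨hmin x hx, ?_⟩
      exact hlt x j (Finset.mem_filter.mp hx).2
    have hlt' : (i : ℕ) < j := hlt i j hij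
    have hadd : (i : ℕ) + ((j : ℕ) - i) = j := by omega
    have hsub := sub_mul_le_sub_of_adjacent hd i ((j : ℕ) - i) (by omega)
    simp only [hadd, Fin.eta] at hsub
    calc _ ≤ (((j : ℕ) - i : ℕ) : ℝ) * d := by gcongr
      _ ≤ w i - w j := hsub
      _ ≤ K * w j := hgap i j hij

/-- Let `A` be an `n × n` pairwise comparison matrix with eigenvalue
priority vector `wEV` (strictly decreasing in the chosen indexing) and geometric mean
priority vector `wGM`, each with pairwise distinct entries. Let `d` be the minimum
adjacent gap of `wEV`, `κ = 1 - KI(A)`, `K = 1/κ² - 1`. If `k` is an integer with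
`0 ≤ k ≤ n(n-1)/2` and `(k+1)·d > K`, then the number of discordant pairs between the
rankings induced by `wEV` and `wGM` is at most `k`. -/
theorem stmt_6 (n : ℕ) (A : Matrix (Fin n) (Fin n) ℝ)
    (hpos : ∀ i j, 0 < A i j)
    (hrec : ∀ i j, A j i = 1 / A i j)
    -- Koczkodaj's inconsistency index `KI(A)`
    (KI : ℝ)
    (hKI : IsGreatest
      {x : ℝ | ∃ i j k : Fin n,
        x = 1 - min (A i j / (A i k * A k j)) ((A i k * A k j) / A i j)} KI)
    -- the eigenvalue (EV) priority vector: positive, normalized, eigenvector of the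
    -- largest (Perron) eigenvalue `lam`
    (wEV : Fin n → ℝ) (lam : ℝ)
    (hEVpos : ∀ i, 0 < wEV i)
    (hEVsum : ∑ i, wEV i = 1)
    (hEVeig : A.mulVec wEV = lam • wEV)
    (hlamMax : ∀ (μ : ℝ) (v : Fin n → ℝ), v ≠ 0 → A.mulVec v = μ • v → μ ≤ lam)
    -- the indexing is such that `wEV` is strictly decreasing (in particular its entries
    -- are pairwise distinct)
    (hdec : ∀ i j : Fin n, i < j → wEV j < wEV i)
    -- the geometric mean (GM) priority vector, with pairwise distinct entries
    (wGM : Fin n → ℝ)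
    (hGM : ∀ i, wGM i =
      (∏ k, A i k) ^ ((n : ℝ)⁻¹) / ∑ j, (∏ k, A j k) ^ ((n : ℝ)⁻¹))
    (hGMinj : Function.Injective wGM)
    -- `d` is the minimum gap between adjacent EV weights
    (d : ℝ)
    (hd : IsLeast
      {x : ℝ | ∃ i : Fin n, ∃ h : (i : ℕ) + 1 < n,
        x = wEV i - wEV ⟨(i : ℕ) + 1, h⟩} d)
    -- `K = 1/κ² - 1` and the integer `k`
    (K : ℝ) (hK : K = 1 / (1 - KI) ^ 2 - 1)
    (k : ℕ) (hkle : 2 * k ≤ n * (n - 1))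
    (hkd1 : ((k : ℝ) + 1) * d > K) :
    -- the number of discordant pairs is at most `k`
    (Finset.univ.filter (fun p : Fin n × Fin n => p.1 < p.2 ∧
        Real.sign (wEV p.1 - wEV p.2) ≠ Real.sign (wGM p.1 - wGM p.2))).card ≤ k := by
  obtain ⟨i₀, j₀, l₀, hKI₀⟩ := hKI.1
  have hκ : 0 < 1 - KI := by
    rw [hKI₀, sub_sub_cancel]
    exact lt_min (div_pos (hpos _ _) (mul_pos (hpos _ _) (hpos _ _)))
      (div_pos (mul_pos (hpos _ _) (hpos _ _)) (hpos _ _))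
  have htriad : ∀ i j l, (1 - KI) * (A i j * A j l) ≤ A i l := fun i j l => by
    have hle := hKI.2 ⟨i, l, j, rfl⟩
    have hmin := min_le_left (A i l / (A i j * A j l)) (A i j * A j l / A i l)
    exact (le_div_iff₀ (mul_pos (hpos i j) (hpos j l))).mp (by linarith)
  have hdiag : A i₀ i₀ = 1 := by
    have h := hrec i₀ i₀
    rw [eq_div_iff (hpos i₀ i₀).ne'] at h
    nlinarith [hpos i₀ i₀]
  have hκ1 : 1 - KI ≤ 1 := by simpa [hdiag] using htriad i₀ i₀ i₀
  have hK0 : 0 ≤ K := by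
    rw [hK, sub_nonneg]
    exact (one_le_div (by positivity)).mpr (pow_le_one₀ hκ.le hκ1)
  have hdgap : ∀ (i : Fin n) (h : (i : ℕ) + 1 < n), d ≤ wEV i - wEV ⟨(i : ℕ) + 1, h⟩ :=
    fun i h => hd.2 ⟨i, h, rfl⟩
  have hdpos : 0 < d := by
    obtain ⟨i, h, rfl⟩ := hd.1
    exact sub_pos.mpr (hdec _ _ (Fin.lt_def.mpr (Nat.lt_succ_self _)))
  have hprod_pos : ∀ i, 0 < ∏ l, A i l := fun i => Finset.prod_pos fun l _ => hpos i l
  have hgap : ∀ i j, (i < j ∧ Real.sign (wEV i - wEV j) ≠ Real.sign (wGM i - wGM j)) →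
      wEV i - wEV j ≤ K * wEV j := by
    rintro i j ⟨hij, hsign⟩
    have hGMle : wGM i ≤ wGM j := by
      by_contra! hlt
      exact hsign (by rw [Real.sign_of_pos (sub_pos.mpr (hdec i j hij)),
        Real.sign_of_pos (sub_pos.mpr hlt)])
    have hrow : ∏ l, A i l ≤ ∏ l, A j l := by
      have hS : 0 < ∑ j, (∏ k, A j k) ^ ((n : ℝ)⁻¹) :=
        Finset.sum_pos (fun l _ => Real.rpow_pos_of_pos (hprod_pos l) _) ⟨i, Finset.mem_univ i⟩
      rw [hGM, hGM, div_le_div_iff_of_pos_right hS] at hGMle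
      have hn : (0 : ℝ) < n := by exact_mod_cast i.pos
      exact (Real.rpow_le_rpow_iff (hprod_pos i).le (hprod_pos j).le (inv_pos.mpr hn)).mp hGMle
    have hA := mul_le_one_of_prod_row_le hpos hκ htriad hrow
    have hEV := mul_eigenvector_le hpos htriad hEVpos hEVeig j i
    rw [hrec i j, mul_one_div, div_mul_eq_mul_div, div_le_iff₀ (hpos i j)] at hEV
    have hratio : wEV i * (1 - KI) ^ 2 ≤ wEV j := by
      calc wEV i * (1 - KI) ^ 2 = (1 - KI) * ((1 - KI) * wEV i) := by ring
        _ ≤ (1 - KI) * (wEV j * A i j) := by gcongr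
        _ = (1 - KI) * A i j * wEV j := by ring
        _ ≤ 1 * wEV j := mul_le_mul_of_nonneg_right hA (hEVpos j).le
        _ = wEV j := one_mul _
    have hdiv := (le_div_iff₀ (pow_pos hκ 2)).mpr hratio
    rw [hK, sub_mul, one_mul, one_div_mul_eq_div]
    linarith
  have hcount := card_pairs_mul_le hdpos.le hK0 hEVpos hdgap
    (fun i j => i < j ∧ Real.sign (wEV i - wEV j) ≠ Real.sign (wGM i - wGM j))
    (fun _ _ h => h.1) hgap
  rw [hEVsum, mul_one] at hcount
  have hlt := lt_of_mul_lt_mul_right (hcount.trans_lt hkd1) hdpos.le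
  exact Nat.lt_succ_iff.mp (by exact_mod_cast hlt)
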